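/- arXiv:2306.04022 — 3 statements merged into one kernel-verified Lean document; each statement's English description precedes it below -/
import Mathlib

section
/- Let (P_n)_{n≥0} be the Pell sequence. The set of pairs (n, m) of positive integers with n > m ≥ 1 such that P_n − P_m is a repdigit in base 10 is exactly {(2,1), (3,2), (3,1), (4,3), (4,1), (7,6)}, with corresponding values P_2 − P_1 = 1, P_3 − P_2 = 3, P_3 − P_1 = 4, P_4 − P_3 = 7, P_4 − P_1 = 11 and P_7 − P_6 = 99. -/
/-- The Pell numbers: `0, 1, 2, 5, 12, 29, …`. -/
def pell : ℕ → ℕ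
  | 0 => 0
  | 1 => 1
  | n + 2 => 2 * pell (n + 1) + pell n

theorem pell_monotone : Monotone pell := by
  refine monotone_nat_of_le_succ fun n => ?_
  match n with
  | 0 => simp [pell]
  | n + 1 => rw [pell]; omega

/-- If `pell` has returned to its initial values modulo `N` at index `T`, it is `T`-periodic
modulo `N`. -/
theorem pell_add_modEq {N T : ℕ} (h₀ : pell T ≡ 0 [MOD N]) (h₁ : pell (T + 1) ≡ 1 [MOD N])
    (n : ℕ) : pell (n + T) ≡ pell n [MOD N] := by
  induction n using Nat.twoStepInduction with
  | zero => simpa [pell] using h₀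
  | one => simpa [pell, add_comm] using h₁
  | more n ih ih' =>
    rw [show n + 2 + T = n + T + 2 by ring, pell, pell, show n + T + 1 = n + 1 + T by ring]
    exact (ih'.mul_left 2).add ih

theorem pell_mod_modEq {N T : ℕ} (h₀ : pell T ≡ 0 [MOD N]) (h₁ : pell (T + 1) ≡ 1 [MOD N])
    (n : ℕ) : pell (n % T) ≡ pell n [MOD N] :=
  Function.Periodic.map_mod_nat (f := fun n => pell n % N) (pell_add_modEq h₀ h₁) n

theorem pow_add_mod_modEq {b c L N : ℕ} (h : b ^ (L + c) ≡ b ^ c [MOD N]) (l : ℕ) :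
    b ^ (l % L + c) ≡ b ^ (l + c) [MOD N] := by
  have hper : Function.Periodic (fun l => b ^ (l + c) % N) L := fun l => by
    have := h.mul_left (b ^ l)
    rwa [← pow_add, ← pow_add, ← add_assoc] at this
  exact hper.map_mod_nat l

/-- `PellRepdigitModEq N n m l a` says that `pell n - pell m` is congruent modulo `N` to the
repdigit with `l + 4` digits all equal to `a` (both multiplied by `9`). -/
abbrev PellRepdigitModEq (N n m l a : ℕ) : Prop :=
  9 * pell n + a ≡ 9 * pell m + a * 10 ^ (l + 4) [MOD N]

theorem PellRepdigitModEq.mod {N T L n m l a : ℕ} (h₀ : pell T ≡ 0 [MOD N])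
    (h₁ : pell (T + 1) ≡ 1 [MOD N]) (h₂ : 10 ^ (L + 4) ≡ 10 ^ 4 [MOD N])
    (h : PellRepdigitModEq N n m l a) : PellRepdigitModEq N (n % T) (m % T) (l % L) a :=
  (((pell_mod_modEq h₀ h₁ n).mul_left 9).add_right a).trans <| h.trans <|
    ((pell_mod_modEq h₀ h₁ m).symm.mul_left 9).add ((pow_add_mod_modEq h₂ l).symm.mul_left a)

set_option synthInstance.maxSize 1000 in
/-- The finite sieve. The expression `(pell i + 9 * pell j) % 10` is the last digit of
`pell i - pell j`. Modulo `8 * 5 * 7 * 11` the Pell sequence has period `24` and the powers of ten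
(from `10 ^ 4` on) have period `6`; modulo `16 * 5 * 7 * 11 * 31 * 41 * 241` the periods are `240`
and `30`. -/
theorem pell_sieve : ∀ i < 24, ∀ j < 24, (pell i + 9 * pell j) % 10 ≠ 0 → ∀ r < 6,
    PellRepdigitModEq (8 * 5 * 7 * 11) i j r ((pell i + 9 * pell j) % 10) →
    ∀ s < 10, ∀ t < 10, ∀ u < 5, ¬ PellRepdigitModEq (16 * 5 * 7 * 11 * 31 * 41 * 241)
      (i + 24 * s) (j + 24 * t) (r + 6 * u) ((pell i + 9 * pell j) % 10) := by
  decide +kernel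

/-- No difference of two Pell numbers is a repdigit with at least four digits. -/
theorem pell_repdigit_exponent_lt {n m k a : ℕ} (ha : 1 ≤ a) (ha' : a ≤ 9)
    (h : 9 * pell n + a = 9 * pell m + a * 10 ^ k) : k < 4 := by
  by_contra! hk
  obtain ⟨l, rfl⟩ := Nat.exists_eq_add_of_le' hk
  have hmod (N : ℕ) : PellRepdigitModEq N n m l a := congrArg (· % N) h
  have hsmall := (hmod (8 * 5 * 7 * 11)).mod (T := 24) (L := 6)
    (by decide +kernel) (by decide +kernel) (by decide +kernel)
  have hbig := (hmod (16 * 5 * 7 * 11 * 31 * 41 * 241)).mod (T := 240) (L := 30)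
    (by decide +kernel) (by decide +kernel) (by decide +kernel)
  have hdigit : (pell (n % 24) + 9 * pell (m % 24)) % 10 = a := by
    have h10 := Nat.ModEq.of_dvd (show 10 ∣ 8 * 5 * 7 * 11 by norm_num) hsmall
    rw [pow_succ, ← mul_assoc] at h10
    unfold Nat.ModEq at h10
    omega
  have hsieve := pell_sieve (n % 24) (Nat.mod_lt _ (by norm_num)) (m % 24)
    (Nat.mod_lt _ (by norm_num))
  rw [hdigit] at hsieve
  refine hsieve (by omega) (l % 6) (Nat.mod_lt _ (by norm_num)) hsmall
    (n / 24 % 10) (Nat.mod_lt _ (by norm_num)) (m / 24 % 10) (Nat.mod_lt _ (by norm_num))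
    (l / 6 % 5) (Nat.mod_lt _ (by norm_num)) ?_
  rwa [← Nat.mod_mul, ← Nat.mod_mul, ← Nat.mod_mul]

theorem index_lt_of_pell_lt {n m : ℕ} (hmn : m < n) (h : pell n < pell m + 1000) : n < 10 := by
  by_contra! hn
  obtain ⟨j, rfl⟩ := Nat.exists_eq_add_of_le' hn
  have h₁ : pell m ≤ pell (j + 9) := pell_monotone (by omega)
  have h₂ : pell 9 ≤ pell (j + 9) := pell_monotone (by omega)
  have h₃ : pell 8 ≤ pell (j + 8) := pell_monotone (by omega)
  have h₄ : pell (j + 10) = 2 * pell (j + 9) + pell (j + 8) := by rw [pell]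
  have h₅ : pell 9 = 985 := rfl
  have h₆ : pell 8 = 408 := rfl
  omega

theorem pell_repdigit_index_mem {n m k a : ℕ} (hm : 1 ≤ m) (hmn : m < n) (hk : 1 ≤ k)
    (ha : 1 ≤ a) (ha' : a ≤ 9) (h : 9 * pell n + a = 9 * pell m + a * 10 ^ k) :
    (n, m) ∈ ({(2, 1), (3, 2), (3, 1), (4, 3), (4, 1), (7, 6)} : Set (ℕ × ℕ)) := by
  have hk' := pell_repdigit_exponent_lt ha ha' h
  have hn : n < 10 := by
    refine index_lt_of_pell_lt hmn ?_
    interval_cases k <;> omega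
  interval_cases n <;> interval_cases m <;> simp [pell] at h ⊢ <;>
    interval_cases k <;> omega

/-- The pairs `(n, m)` with `n > m ≥ 1` such that `P_n − P_m` is a
base-10 repdigit are exactly `(2,1), (3,2), (3,1), (4,3), (4,1), (7,6)`,
with the corresponding values. -/
theorem pell_difference_repdigit_pairs
    (P : ℕ → ℤ) (hP0 : P 0 = 0) (hP1 : P 1 = 1)
    (hPrec : ∀ n : ℕ, P (n + 2) = 2 * P (n + 1) + P n) :
    ({p : ℕ × ℕ | 1 ≤ p.2 ∧ p.2 < p.1 ∧
        ∃ k : ℕ, ∃ a : ℤ, 1 ≤ k ∧ 1 ≤ a ∧ a ≤ 9 ∧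
          9 * (P p.1 - P p.2) = a * (10 ^ k - 1)} =
      ({(2, 1), (3, 2), (3, 1), (4, 3), (4, 1), (7, 6)} : Set (ℕ × ℕ))) ∧
    P 2 - P 1 = 1 ∧ P 3 - P 2 = 3 ∧ P 3 - P 1 = 4 ∧
    P 4 - P 3 = 7 ∧ P 4 - P 1 = 11 ∧ P 7 - P 6 = 99 := by
  have hP : P = fun n => (pell n : ℤ) := by
    funext n
    induction n using Nat.twoStepInduction with
    | zero => simpa [pell] using hP0
    | one => simpa [pell] using hP1
    | more n ih ih' => rw [hPrec, ih, ih', pell]; push_cast; ring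
  subst hP
  refine ⟨Set.ext fun ⟨n, m⟩ => ⟨?_, ?_⟩, by simp [pell]⟩
  · rintro ⟨hm, hmn, k, a, hk, ha, ha', h⟩
    lift a to ℕ using by omega
    dsimp only at hm hmn h
    refine pell_repdigit_index_mem hm hmn hk (by omega) (by omega : a ≤ 9) ?_
    zify
    linear_combination h
  · simp only [Set.mem_insert_iff, Set.mem_singleton_iff, Prod.mk.injEq, Set.mem_ofPred_eq]
    rintro (⟨rfl, rfl⟩ | ⟨rfl, rfl⟩ | ⟨rfl, rfl⟩ | ⟨rfl, rfl⟩ | ⟨rfl, rfl⟩ | ⟨rfl, rfl⟩)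
    · exact ⟨by norm_num, by norm_num, 1, 1, by norm_num [pell]⟩
    · exact ⟨by norm_num, by norm_num, 1, 3, by norm_num [pell]⟩
    · exact ⟨by norm_num, by norm_num, 1, 4, by norm_num [pell]⟩
    · exact ⟨by norm_num, by norm_num, 1, 7, by norm_num [pell]⟩
    · exact ⟨by norm_num, by norm_num, 2, 1, by norm_num [pell]⟩
    · exact ⟨by norm_num, by norm_num, 2, 9, by norm_num [pell]⟩
end

section
/- Let r ≥ 1 and s ∈ {-1, 1} be integers with Δ := r² + 4s > 0, and let (U_n)_{n≥0} be the generalized Lucas sequence with U_0 = 0, U_1 = 1, U_{n+1} = r·U_n + s·U_{n-1}; set δ := (r + √Δ)/2. Let b ≥ 2 be an integer and let k, m, n be positive integers and a an integer with 1 ≤ a ≤ b−1 satisfying a·(b^k − 1)/(b − 1) = U_n − U_m with n > m. Then |1 − δ^{−n}·b^k·(a√Δ)/(b − 1)| < (1 + 3√Δ)/δ^{n−m}. -/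
/-- Binet's formula for a Lucas sequence, with denominators cleared. -/
theorem lucas_binet {r s : ℤ} {U : ℕ → ℤ} (hU0 : U 0 = 0) (hU1 : U 1 = 1)
    (hUrec : ∀ n : ℕ, U (n + 2) = r * U (n + 1) + s * U n) {x y : ℝ}
    (hsum : x + y = r) (hprod : x * y = -s) (n : ℕ) :
    (x - y) * (U n : ℝ) = x ^ n - y ^ n := by
  induction n using Nat.twoStepInduction with
  | zero => simp [hU0]
  | one => simp [hU1]
  | more n h0 h1 =>
    have hs : (s : ℝ) = -(x * y) := by linarith
    rw [hUrec]
    push_cast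
    rw [← hsum, hs]
    linear_combination (x + y) * h1 - x * y * h0

/-- `|1 − δ^{−n}·b^k·(a√Δ)/(b − 1)| < (1 + 3√Δ)/δ^{n−m}`. -/
theorem repdigit_diff_lucas_linear_form_one
    (r s : ℤ) (hr : 1 ≤ r) (hs : s = -1 ∨ s = 1)
    (hΔ : (0 : ℤ) < r ^ 2 + 4 * s)
    (U : ℕ → ℤ) (hU0 : U 0 = 0) (hU1 : U 1 = 1)
    (hUrec : ∀ n : ℕ, U (n + 2) = r * U (n + 1) + s * U n)
    (δ : ℝ) (hδ : δ = ((r : ℝ) + Real.sqrt ((r : ℝ) ^ 2 + 4 * (s : ℝ))) / 2)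
    (b : ℤ) (hb : 2 ≤ b)
    (k m n : ℕ) (hk : 1 ≤ k) (hm : 1 ≤ m) (hn : 1 ≤ n) (hnm : m < n)
    (a : ℤ) (ha1 : 1 ≤ a) (ha2 : a ≤ b - 1)
    (heq : a * (b ^ k - 1) = (U n - U m) * (b - 1)) :
    |1 - δ ^ (-(n : ℤ)) * (b : ℝ) ^ k *
        ((a : ℝ) * Real.sqrt ((r : ℝ) ^ 2 + 4 * s) / ((b : ℝ) - 1))| <
      (1 + 3 * Real.sqrt ((r : ℝ) ^ 2 + 4 * s)) / δ ^ (n - m) := by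
  have hΔ5 : (5 : ℤ) ≤ r ^ 2 + 4 * s := by
    rcases hs with rfl | rfl
    · have : 3 ≤ r := by nlinarith
      nlinarith
    · nlinarith
  have hΔ5' : (5 : ℝ) ≤ (r : ℝ) ^ 2 + 4 * s := by exact_mod_cast hΔ5
  set S := Real.sqrt ((r : ℝ) ^ 2 + 4 * (s : ℝ)) with hS
  have hSsq : S ^ 2 = (r : ℝ) ^ 2 + 4 * s := Real.sq_sqrt (by linarith)
  have hS2 : 2 < S := by
    rw [hS]
    exact Real.lt_sqrt_of_sq_lt (by linarith)
  have hr' : (1 : ℝ) ≤ r := by exact_mod_cast hr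
  have hδ1 : 1 < δ := by rw [hδ]; linarith
  have hδ0 : 0 < δ := by linarith
  obtain ⟨ε, hε⟩ : ∃ ε : ℝ, ε = ((r : ℝ) - S) / 2 := ⟨_, rfl⟩
  have hsum : δ + ε = r := by rw [hδ, hε]; ring
  have hdiff : δ - ε = S := by rw [hδ, hε]; ring
  have hprod : δ * ε = -s := by
    rw [hδ, hε]
    linear_combination (-1 / 4) * hSsq
  have hε1 : |ε| ≤ 1 := by
    have habs : δ * |ε| = 1 := by
      have h := congrArg abs hprod
      rw [abs_mul, abs_of_pos hδ0] at h
      rw [h]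
      rcases hs with rfl | rfl <;> norm_num
    nlinarith [abs_nonneg ε]
  have hεpow (j : ℕ) : |ε ^ j| ≤ 1 := by
    rw [abs_pow]
    exact pow_le_one₀ (abs_nonneg ε) hε1
  have hBn := lucas_binet hU0 hU1 hUrec hsum hprod n
  have hBm := lucas_binet hU0 hU1 hUrec hsum hprod m
  rw [hdiff] at hBn hBm
  have hb' : (0 : ℝ) < (b : ℝ) - 1 := by
    have : (2 : ℝ) ≤ b := by exact_mod_cast hb
    linarith
  have ha1' : (1 : ℝ) ≤ a := by exact_mod_cast ha1
  have ha2' : (a : ℝ) ≤ b - 1 := by exact_mod_cast ha2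
  have heq' : (a : ℝ) * ((b : ℝ) ^ k - 1) = ((U n : ℝ) - U m) * (b - 1) := by
    exact_mod_cast heq
  obtain ⟨c, hc⟩ : ∃ c : ℝ, c = (a : ℝ) / (b - 1) := ⟨_, rfl⟩
  have hc0 : 0 ≤ c := by rw [hc]; exact div_nonneg (by linarith) hb'.le
  have hc1 : c ≤ 1 := by rw [hc]; exact (div_le_one hb').2 ha2'
  have hcU : c * ((b : ℝ) ^ k - 1) = (U n : ℝ) - U m := by
    rw [hc, div_mul_eq_mul_div, heq', mul_div_cancel_right₀ _ hb'.ne']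
  have hpn : 0 < δ ^ n := pow_pos hδ0 n
  have hsplit : δ ^ n = δ ^ (n - m) * δ ^ m := by
    rw [← pow_add, Nat.sub_add_cancel hnm.le]
  have hmain : 1 - δ ^ (-(n : ℤ)) * (b : ℝ) ^ k * ((a : ℝ) * S / ((b : ℝ) - 1)) =
      (δ ^ m + ε ^ n - ε ^ m - c * S) / δ ^ n := by
    have hac : (a : ℝ) * S / ((b : ℝ) - 1) = c * S := by rw [hc]; ring
    rw [hac, zpow_neg, zpow_natCast, eq_div_iff hpn.ne']
    have hinv : (δ ^ n)⁻¹ * δ ^ n = 1 := inv_mul_cancel₀ hpn.ne'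
    linear_combination (-(b : ℝ) ^ k * (c * S)) * hinv - S * hcU - hBn + hBm
  have hpm : 1 ≤ δ ^ m := one_le_pow₀ hδ1.le
  rw [hmain, abs_div, abs_of_pos hpn, div_lt_div_iff₀ hpn (pow_pos hδ0 _), hsplit]
  have hbound : |δ ^ m + ε ^ n - ε ^ m - c * S| < (1 + 3 * S) * δ ^ m := by
    obtain ⟨h1, h2⟩ := abs_le.1 (hεpow n)
    obtain ⟨h3, h4⟩ := abs_le.1 (hεpow m)
    have hcS0 : 0 ≤ c * S := mul_nonneg hc0 (by linarith)
    have hcS1 : c * S ≤ S := mul_le_of_le_one_left (by linarith) hc1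
    have hSm : S ≤ S * δ ^ m := le_mul_of_one_le_right (by linarith) hpm
    rw [abs_lt]
    constructor <;> linarith
  calc
    _ < (1 + 3 * S) * δ ^ m * δ ^ (n - m) :=
      mul_lt_mul_of_pos_right hbound (pow_pos hδ0 _)
    _ = _ := by ring
end

section
/- Let (P_n)_{n≥0} be the Pell sequence. If k, m, n are positive integers and a is an integer with 1 ≤ a ≤ 9 satisfying a·(10^k − 1)/9 = P_n − P_m with n > m, then n < 2.7·10^{31}. -/
theorem eq_pell_of_recurrence {P : ℕ → ℤ} (hP0 : P 0 = 0) (hP1 : P 1 = 1)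
    (hPrec : ∀ n : ℕ, P (n + 2) = 2 * P (n + 1) + P n) (n : ℕ) : P n = pell n := by
  induction n using pell.induct with
  | case1 => simp [hP0, pell]
  | case2 => simp [hP1, pell]
  | case3 n ih₁ ih₂ => simp [hPrec, pell, ih₁, ih₂]

theorem self_le_pell (n : ℕ) : n ≤ pell n := by
  induction n using pell.induct with
  | case1 => simp
  | case2 => simp [pell]
  | case3 n ih₁ ih₂ =>
    simp only [pell]
    omega

theorem pell_succ_ge_add (n : ℕ) : n + pell n ≤ pell (n + 1) + 1 := by
  rcases n with _ | n
  · simp [pell]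
  · have := self_le_pell (n + 1)
    simp only [pell]
    omega

theorem periodic_pell_mod {M p : ℕ} (h₀ : pell p % M = 0) (h₁ : pell (p + 1) % M = 1 % M) :
    Function.Periodic (fun n => pell n % M) p := by
  intro n
  change pell (n + p) ≡ pell n [MOD M]
  induction n using pell.induct with
  | case1 => simpa [pell, Nat.ModEq] using h₀
  | case2 => simpa [pell, Nat.ModEq, add_comm] using h₁
  | case3 n ih₁ ih₂ =>
    rw [show n + 2 + p = n + p + 2 by ring, pell, pell,
      show n + p + 1 = n + 1 + p by ring]
    exact (ih₁.mul_left 2).add ih₂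

theorem periodic_ten_pow_mod {M p c : ℕ} (h : 10 ^ (c + p) % M = 10 ^ c % M) :
    Function.Periodic (fun j => 10 ^ (j + c) % M) p := by
  intro j
  change 10 ^ (j + p + c) ≡ 10 ^ (j + c) [MOD M]
  rw [show j + p + c = j + (c + p) by ring, pow_add, pow_add 10 j c]
  exact Nat.ModEq.mul_left _ h

/-- The congruence modulo `M` implied by `a * (10 ^ (j + 5) - 1) / 9 = pell n - pell m`. -/
def RepdigitCongruence (M a n m j : ℕ) : Prop :=
  a * 10 ^ (j + 5) + 9 * pell m ≡ 9 * pell n + a [MOD M]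

instance (M a n m j : ℕ) : Decidable (RepdigitCongruence M a n m j) :=
  inferInstanceAs (Decidable (_ ≡ _ [MOD M]))

theorem repdigitCongruence_mod {M p q a n m j : ℕ}
    (hp : Function.Periodic (fun n => pell n % M) p)
    (hq : Function.Periodic (fun j => 10 ^ (j + 5) % M) q)
    (h : RepdigitCongruence M a n m j) :
    RepdigitCongruence M a (n % p) (m % p) (j % q) := by
  have hpell (i : ℕ) : pell (i % p) ≡ pell i [MOD M] := hp.map_mod_nat i
  have hpow : 10 ^ (j % q + 5) ≡ 10 ^ (j + 5) [MOD M] := hq.map_mod_nat j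
  exact ((hpow.mul_left a).add ((hpell m).mul_left 9)).trans
    (h.trans (((hpell n).mul_left 9).add_right a).symm)

set_option synthInstance.maxSize 100000 in
/-- A sieve: the residues surviving modulo `14` are lifted modulo `3080 = 8 * 5 * 7 * 11`, and
the few survivors have no lift modulo `20315680 = 32 * 5 * 7 * 11 * 17 * 97`. -/
theorem repdigitCongruence_sieve :
    ∀ n < 6, ∀ m < 6, ∀ j < 6, ∀ a < 10, 0 < a → RepdigitCongruence 14 a n m j →
      ∀ n' < 4, ∀ m' < 4, RepdigitCongruence 3080 a (n + 6 * n') (m + 6 * m') j →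
        ∀ n'' < 4, ∀ m'' < 4, ∀ j' < 16,
          ¬ RepdigitCongruence 20315680 a (n + 6 * n' + 24 * n'') (m + 6 * m' + 24 * m'')
            (j + 6 * j') := by
  decide +kernel

theorem not_repdigit_of_five_le {a n m k : ℕ} (ha : 0 < a) (ha' : a < 10) (hk : 5 ≤ k) :
    a * 10 ^ k + 9 * pell m ≠ 9 * pell n + a := by
  intro h
  obtain ⟨j, rfl⟩ := Nat.exists_eq_add_of_le' hk
  have h₁ : RepdigitCongruence 14 a (n % 6) (m % 6) (j % 6) :=
    repdigitCongruence_mod (periodic_pell_mod (by decide +kernel) (by decide +kernel))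
      (periodic_ten_pow_mod (by norm_num)) (congrArg (· % 14) h)
  have h₂ : RepdigitCongruence 3080 a (n % 24) (m % 24) (j % 6) :=
    repdigitCongruence_mod (periodic_pell_mod (by decide +kernel) (by decide +kernel))
      (periodic_ten_pow_mod (by norm_num)) (congrArg (· % 3080) h)
  have h₃ : RepdigitCongruence 20315680 a (n % 96) (m % 96) (j % 96) :=
    repdigitCongruence_mod (periodic_pell_mod (by decide +kernel) (by decide +kernel))
      (periodic_ten_pow_mod (by decide +kernel)) (congrArg (· % 20315680) h)
  have lift₂ (i : ℕ) : i % 6 + 6 * (i % 24 / 6) = i % 24 := by omega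
  have lift₃ (i : ℕ) : i % 24 + 24 * (i % 96 / 24) = i % 96 := by omega
  have lift_pow : j % 6 + 6 * (j % 96 / 6) = j % 96 := by omega
  refine repdigitCongruence_sieve (n % 6) (by omega) (m % 6) (by omega) (j % 6) (by omega)
    a ha' ha h₁ (n % 24 / 6) (by omega) (m % 24 / 6) (by omega) ?_
    (n % 96 / 24) (by omega) (m % 96 / 24) (by omega) (j % 96 / 6) (by omega) ?_
  · rwa [lift₂, lift₂]
  · rwa [lift₂, lift₂, lift₃, lift₃, lift_pow]

/-- If `a·(10^k − 1)/9 = P_n − P_m` with `n > m ≥ 1`, `k ≥ 1`,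
`1 ≤ a ≤ 9`, then `n < 2.7·10^31`. -/
theorem pell_repdigit_bound_on_n
    (P : ℕ → ℤ) (hP0 : P 0 = 0) (hP1 : P 1 = 1)
    (hPrec : ∀ n : ℕ, P (n + 2) = 2 * P (n + 1) + P n)
    (k m n : ℕ) (hk : 1 ≤ k) (hm : 1 ≤ m) (hn : 1 ≤ n) (hnm : m < n)
    (a : ℤ) (ha1 : 1 ≤ a) (ha2 : a ≤ 9)
    (heq : a * (10 ^ k - 1) = (P n - P m) * 9) :
    (n : ℝ) < 2.7 * 10 ^ 31 := by
  lift a to ℕ using by omega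
  rw [eq_pell_of_recurrence hP0 hP1 hPrec, eq_pell_of_recurrence hP0 hP1 hPrec] at heq
  have h : a * 10 ^ k + 9 * pell m = 9 * pell n + a := by
    zify
    linarith
  have hk5 : k < 5 := by
    by_contra! hk5
    exact not_repdigit_of_five_le (by omega) (by omega) hk5 h
  have hpow : a * 10 ^ k ≤ 9 * 10 ^ 4 :=
    Nat.mul_le_mul (by omega) (Nat.pow_le_pow_right (by norm_num) (by omega))
  have hn' : n < 20000 := by
    obtain ⟨i, rfl⟩ := Nat.exists_eq_add_of_le' hn
    have := pell_succ_ge_add i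
    have := pell_monotone (show m ≤ i by omega)
    omega
  have : (n : ℝ) < 20000 := by exact_mod_cast hn'
  norm_num
  linarith
end
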